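/- Let N = k·n₂ − 1 with k = ⌈(1/n₂)(4γ(1−γ)/(9ρε²) − 1)⌉, where γ = n₁/n₂ ∈ (0,1) is in lowest terms, 4γ(1−γ) > 9ρε², and ρ ≤ 1/6. If U ~ Beta(kn₁, N+1−kn₁), then prob(|U − γ| ≤ ε) ≥ 1 − ρ. -/

import Mathlib

open MeasureTheory

/-- The (normalized) beta density. -/
noncomputable def betaPDF (a b : ℝ) (x : ℝ) : ℝ :=
  if x ∈ Set.Ioo (0 : ℝ) 1 then
    x ^ (a - 1) * (1 - x) ^ (b - 1) / (∫ t in Set.Ioo (0 : ℝ) 1, t ^ (a - 1) * (1 - t) ^ (b - 1))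
  else 0

/-- The Beta(a,b) probability measure on ℝ. -/
noncomputable def betaMeasure (a b : ℝ) : Measure ℝ :=
  volume.withDensity fun x => ENNReal.ofReal (betaPDF a b x)

/-- The signed excess of `x` over the interval `[-ε, ε]`. -/
noncomputable def signedExcess (ε x : ℝ) : ℝ := max (x - ε) 0 + min (x + ε) 0

/-- The indicator function of the complement of `[-ε, ε)`. -/
noncomputable def tailIndicator (ε x : ℝ) : ℝ := if x ∈ Set.Ico (-ε) ε then 0 else 1

lemma signedExcess_of_le {ε x : ℝ} (hε : 0 < ε) (hx : x ≤ -ε) : signedExcess ε x = x + ε := by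
  rw [signedExcess, max_eq_right (by linarith), min_eq_left (by linarith), zero_add]

lemma signedExcess_of_mem {ε x : ℝ} (hx : x ∈ Set.Icc (-ε) ε) : signedExcess ε x = 0 := by
  rw [signedExcess, max_eq_right (by linarith [hx.2]), min_eq_right (by linarith [hx.1]), zero_add]

lemma signedExcess_of_ge {ε x : ℝ} (hε : 0 < ε) (hx : ε ≤ x) : signedExcess ε x = x - ε := by
  rw [signedExcess, max_eq_left (by linarith), min_eq_right (by linarith), add_zero]

lemma signedExcess_neg (ε x : ℝ) : signedExcess ε (-x) = -signedExcess ε x := by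
  unfold signedExcess
  rw [neg_add, ← min_neg_neg, ← max_neg_neg, add_comm]
  ring_nf

lemma continuous_signedExcess (ε : ℝ) : Continuous (signedExcess ε) := by
  unfold signedExcess
  fun_prop

lemma measurable_tailIndicator (ε : ℝ) : Measurable (tailIndicator ε) :=
  Measurable.ite measurableSet_Ico measurable_const measurable_const

lemma tailIndicator_mem (ε x : ℝ) : tailIndicator ε x ∈ Set.Icc (0 : ℝ) 1 := by
  unfold tailIndicator
  split_ifs <;> simp

lemma hasDerivWithinAt_signedExcess {ε : ℝ} (hε : 0 < ε) (x : ℝ) :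
    HasDerivWithinAt (signedExcess ε) (tailIndicator ε x) (Set.Ioi x) x := by
  rcases lt_or_ge x (-ε) with h | h
  · rw [tailIndicator, if_neg fun h' => absurd h'.1 (not_le.2 h)]
    refine (((hasDerivAt_id x).add_const ε).congr_of_eventuallyEq ?_).hasDerivWithinAt
    filter_upwards [Iio_mem_nhds h] with y hy
    exact signedExcess_of_le hε (le_of_lt hy)
  rcases lt_or_ge x ε with h' | h'
  · rw [tailIndicator, if_pos ⟨h, h'⟩]
    refine (hasDerivWithinAt_const x _ (0 : ℝ)).congr_of_eventuallyEq ?_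
      (signedExcess_of_mem ⟨h, h'.le⟩)
    filter_upwards [self_mem_nhdsWithin, mem_nhdsWithin_of_mem_nhds (Iio_mem_nhds h')] with y hy hy'
    exact signedExcess_of_mem ⟨h.trans (le_of_lt hy), le_of_lt hy'⟩
  · rw [tailIndicator, if_neg fun h'' => absurd h''.2 (not_lt.2 h')]
    refine ((hasDerivWithinAt_id x _).sub_const ε).congr (fun y hy => ?_)
      (signedExcess_of_ge hε h')
    exact signedExcess_of_ge hε (h'.trans (le_of_lt hy))

/-- The odd primitive of `4 (x² - c² / 4) / (3 (3ε² - 2c²)) - tailIndicator ε x`. -/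
noncomputable def vpPrimitive (ε c x : ℝ) : ℝ :=
  (4 * x ^ 3 - 3 * c ^ 2 * x) / (9 * (3 * ε ^ 2 - 2 * c ^ 2)) - signedExcess ε x

lemma vpPrimitive_neg (ε c x : ℝ) : vpPrimitive ε c (-x) = -vpPrimitive ε c x := by
  rw [vpPrimitive, vpPrimitive, signedExcess_neg]
  ring

lemma continuous_vpPrimitive (ε c : ℝ) : Continuous (vpPrimitive ε c) := by
  unfold vpPrimitive
  have := continuous_signedExcess ε
  fun_prop

lemma hasDerivWithinAt_vpPrimitive {ε : ℝ} (hε : 0 < ε) (c x : ℝ) :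
    HasDerivWithinAt (vpPrimitive ε c)
      (4 * (x ^ 2 - c ^ 2 / 4) / (3 * (3 * ε ^ 2 - 2 * c ^ 2)) - tailIndicator ε x)
      (Set.Ioi x) x := by
  have h : HasDerivAt (fun x : ℝ => (4 * x ^ 3 - 3 * c ^ 2 * x) / (9 * (3 * ε ^ 2 - 2 * c ^ 2)))
      (4 * (x ^ 2 - c ^ 2 / 4) / (3 * (3 * ε ^ 2 - 2 * c ^ 2))) x := by
    have h1 := ((((hasDerivAt_id x).pow 3).const_mul 4).sub
      ((hasDerivAt_id x).const_mul (3 * c ^ 2))).div_const (9 * (3 * ε ^ 2 - 2 * c ^ 2))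
    convert! h1 using 1
    rw [show 9 * (3 * ε ^ 2 - 2 * c ^ 2) = 3 * (3 * (3 * ε ^ 2 - 2 * c ^ 2)) by ring,
      ← mul_div_mul_left _ _ (three_ne_zero' ℝ)]
    congr 1
    simp
    ring
  exact h.hasDerivWithinAt.sub (hasDerivWithinAt_signedExcess hε x)

lemma vp_cubic_nonneg {ε m x : ℝ} (hm : 0 ≤ m) (hmε : m ≤ ε) (hx : ε ≤ x) :
    m ^ 3 + 9 * (3 * ε ^ 2 - 2 * m ^ 2) * (x - ε) ≤ 4 * x ^ 3 - 3 * m ^ 2 * x := by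
  have hε : 0 ≤ ε := hm.trans hmε
  have key : 4 * x ^ 3 - 3 * m ^ 2 * x - m ^ 3 - 9 * (3 * ε ^ 2 - 2 * m ^ 2) * (x - ε)
      = (2 * x - 3 * ε) ^ 2 * (x + 3 * ε) + m ^ 2 * (15 * x - 18 * ε - m) := by ring
  have h1 : m ^ 2 * (15 * x - 19 * ε) ≤ m ^ 2 * (15 * x - 18 * ε - m) :=
    mul_le_mul_of_nonneg_left (by linarith) (sq_nonneg m)
  have h0 : 0 ≤ (2 * x - 3 * ε) ^ 2 * (x + 3 * ε) := by
    have : 0 ≤ x + 3 * ε := by linarith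
    positivity
  rcases le_total (19 * ε) (15 * x) with h | h
  · have : 0 ≤ m ^ 2 * (15 * x - 19 * ε) := mul_nonneg (sq_nonneg m) (by linarith)
    linarith
  · have h2 : ε ^ 2 * (15 * x - 19 * ε) ≤ m ^ 2 * (15 * x - 19 * ε) :=
      mul_le_mul_of_nonpos_right (by nlinarith) (by linarith)
    have h3 : (2 * x - 3 * ε) ^ 2 * (x + 3 * ε) + ε ^ 2 * (15 * x - 19 * ε)
        = 4 * (x - ε) ^ 2 * (x + 2 * ε) := by ring
    have h4 : 0 ≤ 4 * (x - ε) ^ 2 * (x + 2 * ε) := by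
      have : 0 ≤ x + 2 * ε := by linarith
      positivity
    linarith

lemma vpPrimitive_le_of_mode_mem {ε m : ℝ} (hε : 0 < ε) (hm : 0 ≤ m) (hmε : m ≤ ε) (x : ℝ) :
    (m ≤ x → vpPrimitive ε m m ≤ vpPrimitive ε m x) ∧
      (x ≤ m → vpPrimitive ε m x ≤ vpPrimitive ε m m) := by
  have hD : 0 < 9 * (3 * ε ^ 2 - 2 * m ^ 2) := by nlinarith
  have hmm : vpPrimitive ε m m = m ^ 3 / (9 * (3 * ε ^ 2 - 2 * m ^ 2)) := by
    rw [vpPrimitive, signedExcess_of_mem ⟨by linarith, hmε⟩, sub_zero]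
    ring
  have key : 4 * x ^ 3 - 3 * m ^ 2 * x - m ^ 3 = (x - m) * (2 * x + m) ^ 2 := by ring
  rw [hmm]
  constructor
  · intro h
    rw [vpPrimitive]
    rcases le_total x ε with h' | h'
    · rw [signedExcess_of_mem ⟨by linarith, h'⟩, sub_zero]
      gcongr
      nlinarith [mul_nonneg (sub_nonneg.2 h) (sq_nonneg (2 * x + m))]
    · rw [signedExcess_of_ge hε h', le_sub_iff_add_le, div_add' _ _ _ hD.ne']
      gcongr
      linarith [vp_cubic_nonneg hm hmε h']
  · intro h
    rw [vpPrimitive]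
    rcases le_total (-ε) x with h' | h'
    · rw [signedExcess_of_mem ⟨h', by linarith⟩, sub_zero]
      gcongr
      nlinarith [mul_nonneg (sub_nonneg.2 h) (sq_nonneg (2 * x + m))]
    · rw [signedExcess_of_le hε h', sub_le_iff_le_add, div_add' _ _ _ hD.ne']
      gcongr
      have := vp_cubic_nonneg hm hmε (le_neg_of_le_neg h')
      have : 0 ≤ m ^ 3 := by positivity
      nlinarith

lemma vpPrimitive_le_of_le_mode {ε m : ℝ} (hε : 0 < ε) (hmε : ε ≤ m) (x : ℝ) :
    (m ≤ x → vpPrimitive ε ε m ≤ vpPrimitive ε ε x) ∧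
      (x ≤ m → vpPrimitive ε ε x ≤ vpPrimitive ε ε m) := by
  have mono : ∀ y z, ε ≤ y → y ≤ z → vpPrimitive ε ε y ≤ vpPrimitive ε ε z := by
    intro y z hy hyz
    have hD : 0 < 9 * (3 * ε ^ 2 - 2 * ε ^ 2) := by nlinarith
    rw [vpPrimitive, vpPrimitive, signedExcess_of_ge hε hy, signedExcess_of_ge hε (hy.trans hyz),
      div_sub' hD.ne', div_sub' hD.ne']
    gcongr ?_ / _
    have : 0 ≤ (z - y) * (4 * (y ^ 2 + y * z + z ^ 2) - 12 * ε ^ 2) :=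
      mul_nonneg (by linarith) (by nlinarith)
    linarith
  refine ⟨mono m x hmε, fun h => ?_⟩
  rcases le_total ε x with h1 | h1
  · exact mono x m h1 h
  have hεm := mono ε m le_rfl hmε
  refine ((vpPrimitive_le_of_mode_mem hε hε.le le_rfl x).2 h1).trans hεm

lemma vpPrimitive_le {ε : ℝ} (hε : 0 < ε) (m x : ℝ) :
    (m ≤ x → vpPrimitive ε (min |m| ε) m ≤ vpPrimitive ε (min |m| ε) x) ∧
      (x ≤ m → vpPrimitive ε (min |m| ε) x ≤ vpPrimitive ε (min |m| ε) m) := by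
  have nonneg : ∀ m x, 0 ≤ m →
      (m ≤ x → vpPrimitive ε (min |m| ε) m ≤ vpPrimitive ε (min |m| ε) x) ∧
      (x ≤ m → vpPrimitive ε (min |m| ε) x ≤ vpPrimitive ε (min |m| ε) m) := by
    intro m x hm
    rw [abs_of_nonneg hm]
    rcases le_total m ε with h | h
    · rw [min_eq_left h]
      exact vpPrimitive_le_of_mode_mem hε hm h x
    · rw [min_eq_right h]
      exact vpPrimitive_le_of_le_mode hε h x
  rcases le_total 0 m with hm | hm
  · exact nonneg m x hm
  · have h := nonneg (-m) (-x) (by linarith)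
    rw [abs_neg, vpPrimitive_neg, vpPrimitive_neg] at h
    exact ⟨fun hx => neg_le_neg_iff.1 (h.2 (by linarith)),
      fun hx => neg_le_neg_iff.1 (h.1 (by linarith))⟩

/-- A nonnegative function `f` on `[a, b]` that increases up to `m` and decreases afterwards has
nonnegative integral against `g` when the primitive of `g` vanishing at `m` has the sign of
`x - m`. -/
lemma integral_mul_nonneg_of_unimodal {f f' g H : ℝ → ℝ} {a b m : ℝ} (ham : a ≤ m) (hmb : m ≤ b)
    (hf : ContinuousOn f (Set.Icc a b)) (hf' : IntervalIntegrable f' volume a b)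
    (hderiv : ∀ x ∈ Set.Ioo a b, HasDerivAt f (f' x) x) (hfa : 0 ≤ f a) (hfb : 0 ≤ f b)
    (hinc : ∀ x ∈ Set.Icc a b, x < m → 0 ≤ f' x) (hdec : ∀ x ∈ Set.Icc a b, m < x → f' x ≤ 0)
    (hH : ContinuousOn H (Set.Icc a b)) (hg : IntervalIntegrable g volume a b)
    (hHg : ∀ x ∈ Set.Ioo a b, HasDerivWithinAt H (g x) (Set.Ioi x) x)
    (hHm : H m = 0) (hle : ∀ x, x ≤ m → H x ≤ 0) (hge : ∀ x, m ≤ x → 0 ≤ H x) :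
    0 ≤ ∫ x in a..b, f x * g x := by
  have hab := ham.trans hmb
  rw [intervalIntegral.integral_mul_deriv_eq_deriv_mul_of_hasDeriv_right
    (by rwa [Set.uIcc_of_le hab]) (by rwa [Set.uIcc_of_le hab])
    (by rw [min_eq_left hab, max_eq_right hab]; exact fun x hx => (hderiv x hx).hasDerivWithinAt)
    (by rwa [min_eq_left hab, max_eq_right hab]) hf' hg]
  have hint : 0 ≤ ∫ x in a..b, -(f' x * H x) := by
    refine intervalIntegral.integral_nonneg hab fun x hx => neg_nonneg.2 ?_
    rcases lt_trichotomy x m with h | rfl | h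
    · exact mul_nonpos_of_nonneg_of_nonpos (hinc x hx h) (hle x h.le)
    · simp [hHm]
    · exact mul_nonpos_of_nonpos_of_nonneg (hdec x hx h) (hge x h.le)
  rw [intervalIntegral.integral_neg] at hint
  have := mul_nonneg hfb (hge b hmb)
  have := mul_nonpos_of_nonneg_of_nonpos hfa (hle a ham)
  linarith

lemma intervalIntegrable_mul_tailIndicator {f : ℝ → ℝ} {a b : ℝ}
    (hf : IntervalIntegrable f volume a b) (ε μ : ℝ) :
    IntervalIntegrable (fun x => f x * tailIndicator ε (x - μ)) volume a b := by
  have hmeas : Measurable fun x => tailIndicator ε (x - μ) :=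
    (measurable_tailIndicator ε).comp (measurable_id.sub_const μ)
  have hbound : ∀ x, ‖tailIndicator ε (x - μ)‖ ≤ 1 := fun x => by
    have h := tailIndicator_mem ε (x - μ)
    rw [Real.norm_of_nonneg h.1]
    exact h.2
  exact ⟨hf.1.mul_bdd hmeas.aestronglyMeasurable (Filter.Eventually.of_forall hbound),
    hf.2.mul_bdd hmeas.aestronglyMeasurable (Filter.Eventually.of_forall hbound)⟩

/-- The **Vysochanskij–Petunin inequality** for an unnormalized unimodal density on `[a, b]`. -/
theorem vysochanskij_petunin {f f' : ℝ → ℝ} {a b m μ ε : ℝ} (ham : a ≤ m) (hmb : m ≤ b)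
    (hf : ContinuousOn f (Set.Icc a b)) (hf' : IntervalIntegrable f' volume a b)
    (hderiv : ∀ x ∈ Set.Ioo a b, HasDerivAt f (f' x) x) (hfa : 0 ≤ f a) (hfb : 0 ≤ f b)
    (hinc : ∀ x ∈ Set.Icc a b, x < m → 0 ≤ f' x) (hdec : ∀ x ∈ Set.Icc a b, m < x → f' x ≤ 0)
    (hε : 0 < ε)
    (hvar : 8 * ∫ x in a..b, f x * (x - μ) ^ 2 ≤ 3 * ε ^ 2 * ∫ x in a..b, f x) :
    ∫ x in a..b, f x * tailIndicator ε (x - μ) ≤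
      4 / (9 * ε ^ 2) * ∫ x in a..b, f x * (x - μ) ^ 2 := by
  have hab := ham.trans hmb
  set c := min |m - μ| ε
  have hc0 : 0 ≤ c := le_min (abs_nonneg _) hε.le
  have hcε : c ≤ ε := min_le_right _ _
  have hD : 0 < 3 * ε ^ 2 - 2 * c ^ 2 := by nlinarith
  have hf_int : IntervalIntegrable f volume a b :=
    ContinuousOn.intervalIntegrable (by rwa [Set.uIcc_of_le hab])
  have hf2_int : IntervalIntegrable (fun x => f x * (x - μ) ^ 2) volume a b :=
    hf_int.mul_continuousOn (by fun_prop)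
  have hft_int := intervalIntegrable_mul_tailIndicator hf_int ε μ
  have ht_int : IntervalIntegrable (fun x => tailIndicator ε (x - μ)) volume a b := by
    simpa using intervalIntegrable_mul_tailIndicator
      (intervalIntegrable_const (μ := volume) (a := a) (b := b) (c := (1 : ℝ))) ε μ
  have key : 0 ≤ ∫ x in a..b, f x *
      (4 * ((x - μ) ^ 2 - c ^ 2 / 4) / (3 * (3 * ε ^ 2 - 2 * c ^ 2)) - tailIndicator ε (x - μ)) := by
    refine integral_mul_nonneg_of_unimodal
      (H := fun x => vpPrimitive ε c (x - μ) - vpPrimitive ε c (m - μ)) ham hmb hf hf' hderiv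
      hfa hfb hinc hdec ?_ ?_ ?_ (sub_self _) ?_ ?_
    · have := continuous_vpPrimitive ε c
      fun_prop
    · refine IntervalIntegrable.sub (Continuous.intervalIntegrable (by fun_prop) _ _) ht_int
    · intro x _
      refine HasDerivWithinAt.sub_const _ ?_
      have h := (hasDerivWithinAt_vpPrimitive hε c (x - μ)).comp (h := fun y => y - μ) x
        ((hasDerivWithinAt_id x (Set.Ioi x)).sub_const μ) (fun y hy => sub_lt_sub_right hy μ)
      rw [mul_one] at h
      exact h
    · exact fun x hx => sub_nonpos.2 ((vpPrimitive_le hε (m - μ) (x - μ)).2 (by linarith))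
    · exact fun x hx => sub_nonneg.2 ((vpPrimitive_le hε (m - μ) (x - μ)).1 (by linarith))
  set S := ∫ x in a..b, f x
  set V := ∫ x in a..b, f x * (x - μ) ^ 2
  set T := ∫ x in a..b, f x * tailIndicator ε (x - μ)
  have hexp : ∫ x in a..b, f x *
      (4 * ((x - μ) ^ 2 - c ^ 2 / 4) / (3 * (3 * ε ^ 2 - 2 * c ^ 2)) - tailIndicator ε (x - μ))
      = 4 / (3 * (3 * ε ^ 2 - 2 * c ^ 2)) * V - c ^ 2 / (3 * (3 * ε ^ 2 - 2 * c ^ 2)) * S - T := by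
    rw [← intervalIntegral.integral_const_mul, ← intervalIntegral.integral_const_mul,
      ← intervalIntegral.integral_sub (hf2_int.const_mul _) (hf_int.const_mul _),
      ← intervalIntegral.integral_sub ((hf2_int.const_mul _).sub (hf_int.const_mul _)) hft_int]
    congr 1
    ext x
    ring
  rw [hexp] at key
  have hlast : 4 / (3 * (3 * ε ^ 2 - 2 * c ^ 2)) * V - c ^ 2 / (3 * (3 * ε ^ 2 - 2 * c ^ 2)) * S
      ≤ 4 / (9 * ε ^ 2) * V := by
    have : 4 / (9 * ε ^ 2) * V -
        (4 / (3 * (3 * ε ^ 2 - 2 * c ^ 2)) * V - c ^ 2 / (3 * (3 * ε ^ 2 - 2 * c ^ 2)) * S)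
        = c ^ 2 * (3 * ε ^ 2 * S - 8 * V) / (9 * ε ^ 2 * (3 * ε ^ 2 - 2 * c ^ 2)) := by
      generalize hd : 3 * ε ^ 2 - 2 * c ^ 2 = d at hD ⊢
      field_simp
      rw [← hd]
      ring
    have : 0 ≤ c ^ 2 * (3 * ε ^ 2 * S - 8 * V) / (9 * ε ^ 2 * (3 * ε ^ 2 - 2 * c ^ 2)) :=
      div_nonneg (mul_nonneg (sq_nonneg c) (by linarith)) (by positivity)
    linarith
  linarith

/-- Beta moment recurrence. -/
lemma integral_beta_recurrence (p q : ℕ) :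
    ((p : ℝ) + q + 2) * ∫ x in (0 : ℝ)..1, x ^ (p + 1) * (1 - x) ^ q =
      (p + 1) * ∫ x in (0 : ℝ)..1, x ^ p * (1 - x) ^ q := by
  have h : ∫ x in (0 : ℝ)..1, ((p + 1) * (x ^ p * (1 - x) ^ q) -
      (p + q + 2) * (x ^ (p + 1) * (1 - x) ^ q)) = 0 := by
    rw [intervalIntegral.integral_eq_sub_of_hasDerivAt
      (f := fun x : ℝ => x ^ (p + 1) * (1 - x) ^ (q + 1))
      (fun x _ => ?_) (Continuous.intervalIntegrable (by fun_prop) _ _)]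
    · simp
    · convert! (hasDerivAt_pow (p + 1) x).mul (((hasDerivAt_id x).const_sub 1).pow (q + 1)) using 1
      simp
      ring
  rw [intervalIntegral.integral_sub (Continuous.intervalIntegrable (by fun_prop) _ _)
    (Continuous.intervalIntegrable (by fun_prop) _ _), intervalIntegral.integral_const_mul,
    intervalIntegral.integral_const_mul] at h
  linarith

lemma integral_beta_pos (p q : ℕ) : 0 < ∫ x in (0 : ℝ)..1, x ^ p * (1 - x) ^ q := by
  refine intervalIntegral.intervalIntegral_pos_of_pos_on
    (Continuous.intervalIntegrable (by fun_prop) _ _) (fun x hx => ?_) one_pos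
  have : 0 < 1 - x := by linarith [hx.2]
  have := hx.1
  positivity

/-- The second moment of an unnormalized beta density about its mean. -/
lemma integral_beta_variance (p q : ℕ) {γ : ℝ} (hγ : γ * ((p : ℝ) + q + 2) = p + 1) :
    ∫ x in (0 : ℝ)..1, x ^ p * (1 - x) ^ q * (x - γ) ^ 2 =
      γ * (1 - γ) / (p + q + 3) * ∫ x in (0 : ℝ)..1, x ^ p * (1 - x) ^ q := by
  have h1 := integral_beta_recurrence p q
  have h2 := integral_beta_recurrence (p + 1) q
  have hexp : ∫ x in (0 : ℝ)..1, x ^ p * (1 - x) ^ q * (x - γ) ^ 2 =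
      (∫ x in (0 : ℝ)..1, x ^ (p + 1 + 1) * (1 - x) ^ q) -
        2 * γ * (∫ x in (0 : ℝ)..1, x ^ (p + 1) * (1 - x) ^ q) +
        γ ^ 2 * ∫ x in (0 : ℝ)..1, x ^ p * (1 - x) ^ q := by
    rw [← intervalIntegral.integral_const_mul, ← intervalIntegral.integral_const_mul,
      ← intervalIntegral.integral_sub, ← intervalIntegral.integral_add]
    · congr 1
      ext x
      ring
    all_goals exact Continuous.intervalIntegrable (by fun_prop) _ _
  rw [hexp]
  set S := ∫ x in (0 : ℝ)..1, x ^ p * (1 - x) ^ q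
  set S1 := ∫ x in (0 : ℝ)..1, x ^ (p + 1) * (1 - x) ^ q
  set S2 := ∫ x in (0 : ℝ)..1, x ^ (p + 1 + 1) * (1 - x) ^ q
  push_cast at h2
  have hn : (p : ℝ) + q + 2 ≠ 0 := by positivity
  have hn' : (p : ℝ) + q + 3 ≠ 0 := by positivity
  have e1 : S1 = γ * S := by
    apply mul_left_cancel₀ hn
    rw [h1, ← hγ]
    ring
  have e2 : ((p : ℝ) + q + 3) * S2 = (p + 2) * (γ * S) := by
    rw [← e1]
    linarith
  rw [e1, div_mul_eq_mul_div, eq_div_iff hn']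
  linear_combination e2 - γ * S * hγ

/-- The Vysochanskij–Petunin inequality for an unnormalized beta density. -/
lemma beta_tail_le (p q : ℕ) {γ ε : ℝ} (hγ : γ * ((p : ℝ) + q + 2) = p + 1) (hε : 0 < ε)
    (hvar : 8 * (γ * (1 - γ) / (p + q + 3)) ≤ 3 * ε ^ 2) :
    ∫ x in (0 : ℝ)..1, x ^ p * (1 - x) ^ q * tailIndicator ε (x - γ) ≤
      4 / (9 * ε ^ 2) * (γ * (1 - γ) / (p + q + 3)) * ∫ x in (0 : ℝ)..1, x ^ p * (1 - x) ^ q := by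
  have hV := integral_beta_variance p q hγ
  have hS := integral_beta_pos p q
  have hmode : (p : ℝ) / (p + q) ≤ 1 := div_le_one_of_le₀ (by simp) (by positivity)
  have hsign : ∀ x ∈ Set.Icc (0 : ℝ) 1,
      (x < (p : ℝ) / (p + q) → 0 ≤ (p : ℝ) * x ^ (p - 1) * (1 - x) ^ q -
        x ^ p * (q * (1 - x) ^ (q - 1))) ∧
      ((p : ℝ) / (p + q) < x → (p : ℝ) * x ^ (p - 1) * (1 - x) ^ q -
        x ^ p * (q * (1 - x) ^ (q - 1)) ≤ 0) := by
    intro x ⟨hx0, hx1⟩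
    have hx1' : 0 ≤ 1 - x := by linarith
    rcases p with _ | p
    · refine ⟨fun h => absurd h (by simpa using hx0), fun _ => ?_⟩
      have : 0 ≤ (q : ℝ) * (1 - x) ^ (q - 1) := by positivity
      simpa using this
    rcases q with _ | q
    · have hp : ((p + 1 : ℕ) : ℝ) ≠ 0 := by positivity
      refine ⟨fun _ => ?_, fun h => absurd h ?_⟩
      · simp
        positivity
      · rw [Nat.cast_zero, add_zero, div_self hp]
        exact not_lt.2 hx1
    have hpq : 0 < ((p + 1 : ℕ) : ℝ) + ((q + 1 : ℕ) : ℝ) := by positivity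
    have e : ((p + 1 : ℕ) : ℝ) * x ^ (p + 1 - 1) * (1 - x) ^ (q + 1) -
        x ^ (p + 1) * (((q + 1 : ℕ) : ℝ) * (1 - x) ^ (q + 1 - 1)) =
        x ^ p * (1 - x) ^ q *
          (((p + 1 : ℕ) : ℝ) - x * (((p + 1 : ℕ) : ℝ) + ((q + 1 : ℕ) : ℝ))) := by
      simp only [Nat.add_sub_cancel]
      ring
    rw [e, lt_div_iff₀ hpq, div_lt_iff₀ hpq]
    exact ⟨fun h => mul_nonneg (by positivity) (by linarith),
      fun h => mul_nonpos_of_nonneg_of_nonpos (by positivity) (by linarith)⟩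
  have h := vysochanskij_petunin (f := fun x : ℝ => x ^ p * (1 - x) ^ q)
    (f' := fun x : ℝ => (p : ℝ) * x ^ (p - 1) * (1 - x) ^ q - x ^ p * (q * (1 - x) ^ (q - 1)))
    (a := 0) (b := 1) (m := (p : ℝ) / (p + q)) (μ := γ) (ε := ε) (by positivity) hmode
    (by fun_prop) (Continuous.intervalIntegrable (by fun_prop) _ _) (fun x _ => ?_)
    (by simp) (by simp) (fun x hx => (hsign x hx).1) (fun x hx => (hsign x hx).2) hε ?_
  · rwa [hV, ← mul_assoc] at h
  · convert! (hasDerivAt_pow p x).mul (((hasDerivAt_id x).const_sub 1).pow q) using 1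
    simp
    ring
  · rw [hV, ← mul_assoc]
    exact mul_le_mul_of_nonneg_right hvar hS.le

lemma betaPDF_add_one_eq (p q : ℕ) {x : ℝ} (hx : x ∈ Set.Ioo (0 : ℝ) 1) :
    betaPDF (p + 1) (q + 1) x =
      x ^ p * (1 - x) ^ q / ∫ x in (0 : ℝ)..1, x ^ p * (1 - x) ^ q := by
  rw [betaPDF, if_pos hx, intervalIntegral.integral_of_le zero_le_one,
    integral_Ioc_eq_integral_Ioo]
  simp only [add_sub_cancel_right, Real.rpow_natCast]

/-- The beta mass of an interval about `γ` is at least one minus the normalized tail integral. -/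
lemma ofReal_le_betaMeasure (p q : ℕ) {γ ε ρ : ℝ}
    (h : ∫ x in (0 : ℝ)..1, x ^ p * (1 - x) ^ q * tailIndicator ε (x - γ) ≤
      ρ * ∫ x in (0 : ℝ)..1, x ^ p * (1 - x) ^ q) :
    ENNReal.ofReal (1 - ρ) ≤ betaMeasure (p + 1) (q + 1) {x : ℝ | |x - γ| ≤ ε} := by
  have hS := integral_beta_pos p q
  set S := ∫ x in (0 : ℝ)..1, x ^ p * (1 - x) ^ q
  have hf_int : IntervalIntegrable (fun x : ℝ => x ^ p * (1 - x) ^ q) volume 0 1 :=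
    Continuous.intervalIntegrable (by fun_prop) _ _
  have ht_int := intervalIntegrable_mul_tailIndicator hf_int ε γ
  have hg_int := (hf_int.sub ht_int).div_const S
  have hmem : MeasurableSet {x : ℝ | |x - γ| ≤ ε} :=
    measurableSet_le (by fun_prop) measurable_const
  calc ENNReal.ofReal (1 - ρ)
      ≤ ENNReal.ofReal (∫ x in (0 : ℝ)..1, (x ^ p * (1 - x) ^ q -
          x ^ p * (1 - x) ^ q * tailIndicator ε (x - γ)) / S) := by
        apply ENNReal.ofReal_le_ofReal
        rw [intervalIntegral.integral_div, intervalIntegral.integral_sub hf_int ht_int,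
          le_div_iff₀ hS]
        linarith
    _ = ∫⁻ x in Set.Ioo (0 : ℝ) 1, ENNReal.ofReal ((x ^ p * (1 - x) ^ q -
          x ^ p * (1 - x) ^ q * tailIndicator ε (x - γ)) / S) := by
        rw [intervalIntegral.integral_of_le zero_le_one, integral_Ioc_eq_integral_Ioo]
        refine ofReal_integral_eq_lintegral_ofReal ?_ ?_
        · exact ((intervalIntegrable_iff_integrableOn_Ioo_of_le zero_le_one).1 hg_int)
        · refine ae_restrict_of_forall_mem measurableSet_Ioo fun x hx => ?_
          have h0 : 0 ≤ 1 - x := by linarith [hx.2]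
          have h1 := hx.1
          have h2 := sub_nonneg.2 (tailIndicator_mem ε (x - γ)).2
          have : 0 ≤ x ^ p * (1 - x) ^ q * (1 - tailIndicator ε (x - γ)) / S := by positivity
          simpa [mul_sub] using this
    _ ≤ ∫⁻ x in Set.Ioo (0 : ℝ) 1, {x : ℝ | |x - γ| ≤ ε}.indicator
          (fun x => ENNReal.ofReal (betaPDF (p + 1) (q + 1) x)) x := by
        refine setLIntegral_mono' measurableSet_Ioo fun x hx => ?_
        by_cases hxε : x - γ ∈ Set.Ico (-ε) ε
        · rw [Set.indicator_of_mem (show x ∈ {x : ℝ | |x - γ| ≤ ε} from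
            abs_le.2 ⟨hxε.1, hxε.2.le⟩), betaPDF_add_one_eq p q hx, tailIndicator, if_pos hxε,
            mul_zero, sub_zero]
        · rw [tailIndicator, if_neg hxε]
          simp
    _ ≤ ∫⁻ x, {x : ℝ | |x - γ| ≤ ε}.indicator
          (fun x => ENNReal.ofReal (betaPDF (p + 1) (q + 1) x)) x := setLIntegral_le_lintegral _ _
    _ = betaMeasure (p + 1) (q + 1) {x : ℝ | |x - γ| ≤ ε} := by
        rw [lintegral_indicator hmem, betaMeasure, withDensity_apply _ hmem]

/-- Vysochanskij–Petunin-based finite sample guarantee: with `N = kn₂ − 1`,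
`k = ⌈(1/n₂)(4γ(1−γ)/(9ρε²) − 1)⌉`, `4γ(1−γ) > 9ρε²` and `ρ ≤ 1/6`, a
`Beta(kn₁, N+1−kn₁)` random variable `U` satisfies `prob(|U − γ| ≤ ε) ≥ 1 − ρ`. -/
theorem vp_finite_sample_guarantee
    (n₁ n₂ : ℕ) (hn₁ : 0 < n₁) (hn₂ : 0 < n₂) (hcop : Nat.Coprime n₁ n₂)
    (γ ε ρ : ℝ) (hγdef : γ = (n₁ : ℝ) / n₂) (hγ : γ ∈ Set.Ioo (0 : ℝ) 1)
    (hε : 0 < ε) (hρ : 0 < ρ) (hρ6 : ρ ≤ 1 / 6)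
    (hcond : 4 * γ * (1 - γ) > 9 * ρ * ε ^ 2)
    (k : ℕ) (hk : (k : ℤ) = ⌈(1 / (n₂ : ℝ)) * (4 * γ * (1 - γ) / (9 * ρ * ε ^ 2) - 1)⌉)
    (N : ℕ) (hN : (N : ℝ) = (k : ℝ) * n₂ - 1) :
    ENNReal.ofReal (1 - ρ) ≤
      betaMeasure ((k : ℝ) * n₁) ((N : ℝ) + 1 - (k : ℝ) * n₁) {x : ℝ | |x - γ| ≤ ε} := by
  obtain ⟨hγ0, hγ1⟩ := hγ
  have hn₂' : (0 : ℝ) < n₂ := by exact_mod_cast hn₂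
  have hγn : γ * n₂ = n₁ := by rw [hγdef, div_mul_cancel₀ _ hn₂'.ne']
  have hρε : 0 < 9 * ρ * ε ^ 2 := by positivity
  have hratio : 1 < 4 * γ * (1 - γ) / (9 * ρ * ε ^ 2) := (one_lt_div hρε).2 hcond
  have hk0 : 0 < k := by
    have : (0 : ℤ) < k := by
      rw [hk, Int.ceil_pos]
      exact mul_pos (by positivity) (by linarith)
    exact_mod_cast this
  have hkle : 1 / (n₂ : ℝ) * (4 * γ * (1 - γ) / (9 * ρ * ε ^ 2) - 1) ≤ k := by
    have := Int.le_ceil (1 / (n₂ : ℝ) * (4 * γ * (1 - γ) / (9 * ρ * ε ^ 2) - 1))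
    rw [← hk] at this
    exact_mod_cast this
  have hkn : 4 * γ * (1 - γ) ≤ (k * n₂ + 1) * (9 * ρ * ε ^ 2) := by
    rw [one_div, inv_mul_le_iff₀ hn₂'] at hkle
    rw [← div_le_iff₀ hρε]
    linarith
  have hlt : n₁ < n₂ := by
    have : (n₁ : ℝ) < n₂ := by nlinarith
    exact_mod_cast this
  obtain ⟨p, hp⟩ : ∃ p, k * n₁ = p + 1 := Nat.exists_eq_succ_of_ne_zero (by positivity)
  obtain ⟨q, hq⟩ : ∃ q, k * (n₂ - n₁) = q + 1 :=
    Nat.exists_eq_succ_of_ne_zero (Nat.mul_pos hk0 (Nat.sub_pos_of_lt hlt)).ne'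
  have hp' : (k : ℝ) * n₁ = p + 1 := by exact_mod_cast hp
  have hq' : (k : ℝ) * (n₂ - n₁) = q + 1 := by
    rw [← Nat.cast_sub hlt.le]
    exact_mod_cast hq
  have hpq : (p : ℝ) + q + 2 = k * n₂ := by linarith
  have hb : (N : ℝ) + 1 - k * n₁ = q + 1 := by
    rw [hN]
    linarith
  have hγpq : γ * ((p : ℝ) + q + 2) = p + 1 := by
    rw [hpq, ← hp', ← hγn]
    ring
  have hvar : 4 * (γ * (1 - γ) / (p + q + 3)) ≤ 9 * ρ * ε ^ 2 := by
    rw [← mul_div_assoc, div_le_iff₀ (by positivity)]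
    have : (p : ℝ) + q + 3 = k * n₂ + 1 := by linarith
    rw [this]
    linarith
  rw [hb, hp']
  refine ofReal_le_betaMeasure p q
    ((beta_tail_le p q hγpq hε ?_).trans (mul_le_mul_of_nonneg_right ?_ (integral_beta_pos p q).le))
  · nlinarith [mul_le_mul_of_nonneg_right hρ6 (sq_nonneg ε)]
  · rw [div_mul_eq_mul_div, div_le_iff₀ (by positivity)]
    linarith
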